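/- arXiv:1502.03836 — 4 statements merged into one kernel-verified Lean document; each statement's English description precedes it below -/
import Mathlib

section
/- Let n ≥ 1 and M ≥ 1 be integers, let Y_1, …, Y_n be nonnegative real numbers, and let a(i,m) ∈ {0,1} for 1 ≤ i ≤ n, 1 ≤ m ≤ M. Set N_m = Σ_{i=1}^n a(i,m) and suppose there exist real numbers 0 < A ≤ B such that A ≤ N_m ≤ B for every m. Define the forest value F = (1/M) Σ_{m=1}^M Σ_{i=1}^n Y_i a(i,m)/N_m and the KeRF value G = (Σ_{m=1}^M Σ_{i=1}^n Y_i a(i,m)) / (Σ_{m=1}^M N_m). Then |F/G − 1| ≤ (B−A)/A, with the convention that F/G = 1 when G = 0. -/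
open Finset

/-- If the weighted sums satisfy `A * T ≤ S ≤ B * T` and the total weight `N` lies between
`K * A` and `K * B`, then `(T / K) / (S / N)` is within `(B - A) / A` of `1`. -/
theorem abs_mean_div_ratio_sub_one_le {A B K S T N : ℝ} (hA : 0 < A) (hAB : A ≤ B)
    (hK : 0 < K) (hS : 0 < S) (hTS : A * T ≤ S) (hST : S ≤ B * T)
    (hKN : K * A ≤ N) (hNK : N ≤ K * B) :
    |((1 / K) * T) / (S / N) - 1| ≤ (B - A) / A := by
  have hB : 0 < B := hA.trans_le hAB
  have hN : 0 < N := (mul_pos hK hA).trans_le hKN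
  have hT : 0 < T := pos_of_mul_pos_right (hS.trans_le hST) hB.le
  have hratio : ((1 / K) * T) / (S / N) = (T * N) / (K * S) := by
    field_simp
  have hupper : (T * N) / (K * S) ≤ B / A := by
    rw [div_le_div_iff₀ (by positivity) hA]
    calc T * N * A = (A * T) * N := by ring
      _ ≤ S * (K * B) := mul_le_mul hTS hNK hN.le hS.le
      _ = B * (K * S) := by ring
  have hlower : A / B ≤ (T * N) / (K * S) := by
    rw [div_le_div_iff₀ hB (by positivity)]
    calc A * (K * S) = S * (K * A) := by ring
      _ ≤ (B * T) * N := mul_le_mul hST hKN (by positivity) (by positivity)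
      _ = T * N * B := by ring
  have hBA : (B - A) / A = B / A - 1 := by field_simp
  have hBA' : (B - A) / B = 1 - A / B := by field_simp
  have hle : (B - A) / B ≤ (B - A) / A :=
    div_le_div_of_nonneg_left (sub_nonneg.2 hAB) hA hAB
  rw [hratio, abs_le]
  constructor <;> linarith

/-- Comparison between a finite random forest estimate and its KeRF modification
(pointwise, at a fixed query point). -/
theorem finite_forest_kerf_comparison
    (n M : ℕ) (hn : 1 ≤ n) (hM : 1 ≤ M)
    (Y : Fin n → ℝ) (hY : ∀ i, 0 ≤ Y i)
    (a : Fin n → Fin M → ℝ) (ha : ∀ i m, a i m = 0 ∨ a i m = 1)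
    (A B : ℝ) (hA : 0 < A) (hAB : A ≤ B)
    (hbounds : ∀ m : Fin M, A ≤ ∑ i, a i m ∧ ∑ i, a i m ≤ B) :
    |(if (∑ m, ∑ i, Y i * a i m) / (∑ m, ∑ i, a i m) = 0 then (1 : ℝ)
      else ((1 / M) * ∑ m, ∑ i, Y i * a i m / (∑ i', a i' m)) /
        ((∑ m, ∑ i, Y i * a i m) / (∑ m, ∑ i, a i m))) - 1|
      ≤ (B - A) / A := by
  have hM' : (0 : ℝ) < M := by exact_mod_cast hM
  have hcell (m : Fin M) : 0 < ∑ i, a i m := hA.trans_le (hbounds m).1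
  have hterm (i : Fin n) (m : Fin M) : 0 ≤ Y i * a i m :=
    mul_nonneg (hY i) (by rcases ha i m with h | h <;> simp [h])
  split_ifs with hG
  · simpa using div_nonneg (sub_nonneg.2 hAB) hA.le
  have hS : 0 < ∑ m, ∑ i, Y i * a i m :=
    (sum_nonneg fun m _ => sum_nonneg fun i _ => hterm i m).lt_of_ne'
      fun h => hG (by rw [h, zero_div])
  refine abs_mean_div_ratio_sub_one_le hA hAB hM' hS ?_ ?_ ?_ ?_
  · simp only [mul_sum]
    refine sum_le_sum fun m _ => sum_le_sum fun i _ => ?_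
    rw [← mul_div_assoc, div_le_iff₀ (hcell m), mul_comm]
    exact mul_le_mul_of_nonneg_left (hbounds m).1 (hterm i m)
  · simp only [mul_sum]
    refine sum_le_sum fun m _ => sum_le_sum fun i _ => ?_
    rw [← mul_div_assoc, le_div_iff₀ (hcell m), mul_comm B]
    exact mul_le_mul_of_nonneg_left (hbounds m).2 (hterm i m)
  · simpa using card_nsmul_le_sum univ (fun m => ∑ i, a i m) A fun m _ => (hbounds m).1
  · simpa using sum_le_card_nsmul univ (fun m => ∑ i, a i m) B fun m _ => (hbounds m).2
end

section
/- Let (Ω, 𝔽, P) be a probability space, n ≥ 1 an integer, Y_1, …, Y_n nonnegative real numbers, and B_1, …, B_n : Ω → {0,1} measurable functions with N = Σ_{i=1}^n B_i. Suppose there exist real numbers 1 ≤ A ≤ B and ε ≥ 0 such that A ≤ E[N] ≤ B and P(A ≤ N ≤ B) ≥ 1 − ε. Define m₁ = Σ_{i=1}^n Y_i E[B_i/N] (with the convention B_i/N = 0 on the event {N = 0}) and m₂ = Σ_{i=1}^n Y_i E[B_i] / E[N]. Then |m₁ − m₂| ≤ ((B−A)/A)·m₂ + n·ε·(max_{1≤i≤n}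 Y_i). -/
open MeasureTheory Finset

/-- If `N` and `M` both lie in `[A, B]`, then `s / N` and `s / M` differ by at most a relative error
`(B - A) / A`. -/
theorem abs_div_sub_div_le_of_mem_Icc {A B N M s : ℝ} (hA : 0 < A) (hs : 0 ≤ s)
    (hAN : A ≤ N) (hNB : N ≤ B) (hAM : A ≤ M) (hMB : M ≤ B) :
    |s / N - s / M| ≤ (B - A) / A * (s / M) := by
  have hN : 0 < N := hA.trans_le hAN
  have hM : 0 < M := hA.trans_le hAM
  have h : s / N - s / M = (M - N) / N * (s / M) := by field_simp
  rw [h, abs_mul, abs_of_nonneg (div_nonneg hs hM.le), abs_div, abs_of_pos hN]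
  have hMN : |M - N| ≤ B - A := abs_le.2 ⟨by linarith, by linarith⟩
  have hBA : 0 ≤ B - A := by linarith
  gcongr

/-- Comparison between an infinite random forest estimate and its KeRF modification
(pointwise, at a fixed query point). -/
theorem infinite_forest_kerf_comparison
    {Ω : Type*} [MeasurableSpace Ω] (P : Measure Ω) [IsProbabilityMeasure P]
    (n : ℕ) (hn : 1 ≤ n)
    (Y : Fin n → ℝ) (hY : ∀ i, 0 ≤ Y i)
    (B' : Fin n → Ω → ℝ) (hBmeas : ∀ i, Measurable (B' i))
    (hBval : ∀ i ω, B' i ω = 0 ∨ B' i ω = 1)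
    (A B ε : ℝ) (hA : 1 ≤ A) (hAB : A ≤ B) (hε : 0 ≤ ε)
    (hEN₁ : A ≤ ∫ ω, (∑ i, B' i ω) ∂P)
    (hEN₂ : ∫ ω, (∑ i, B' i ω) ∂P ≤ B)
    (hP : ENNReal.ofReal (1 - ε) ≤ P {ω | A ≤ ∑ i, B' i ω ∧ ∑ i, B' i ω ≤ B}) :
    |(∑ i, Y i * ∫ ω, (B' i ω / ∑ j, B' j ω) ∂P)
        - ∑ i, Y i * (∫ ω, B' i ω ∂P) / (∫ ω, (∑ j, B' j ω) ∂P)|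
      ≤ ((B - A) / A) * (∑ i, Y i * (∫ ω, B' i ω ∂P) / (∫ ω, (∑ j, B' j ω) ∂P))
        + n * ε * (⨆ i, Y i) := by
  classical
  set M := ∫ ω, (∑ i, B' i ω) ∂P
  set K := ⨆ i, Y i
  have hYK (i) : Y i ≤ K := le_ciSup (Set.finite_range Y).bddAbove i
  have hK0 : 0 ≤ K := Real.iSup_nonneg hY
  have hn' : (1 : ℝ) ≤ n := by exact_mod_cast hn
  have hA0 : 0 < A := by linarith
  have hM1 : 1 ≤ M := hA.trans hEN₁
  have hB0 (i ω) : 0 ≤ B' i ω := by rcases hBval i ω with h | h <;> simp [h]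
  have hB1 (i ω) : B' i ω ≤ 1 := by rcases hBval i ω with h | h <;> simp [h]
  have hN0 (ω) : 0 ≤ ∑ j, B' j ω := sum_nonneg fun j _ => hB0 j ω
  have hNm : Measurable fun ω => ∑ j, B' j ω := Finset.measurable_sum _ fun j _ => hBmeas j
  have hBint (i) : Integrable (B' i) P :=
    .of_bound (hBmeas i).aestronglyMeasurable 1 (ae_of_all _ fun ω => by
      rw [Real.norm_of_nonneg (hB0 i ω)]; exact hB1 i ω)
  have hDint (i) : Integrable (fun ω => B' i ω / ∑ j, B' j ω) P :=
    .of_bound ((hBmeas i).div hNm).aestronglyMeasurable 1 (ae_of_all _ fun ω => by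
      rw [Real.norm_of_nonneg (div_nonneg (hB0 i ω) (hN0 ω))]
      exact div_le_one_of_le₀
        (single_le_sum (f := fun j => B' j ω) (fun j _ => hB0 j ω) (mem_univ i)) (hN0 ω))
  let S : Ω → ℝ := fun ω => ∑ i, Y i * B' i ω
  have hSint : Integrable S P := integrable_finsetSum _ fun i _ => (hBint i).const_mul _
  have hS0 (ω) : 0 ≤ S ω := sum_nonneg fun i _ => mul_nonneg (hY i) (hB0 i ω)
  have hSN (ω) : S ω ≤ K * ∑ j, B' j ω := by
    rw [mul_sum]
    exact sum_le_sum fun i _ => mul_le_mul_of_nonneg_right (hYK i) (hB0 i ω)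
  have hNn (ω) : ∑ j, B' j ω ≤ n := by
    simpa using sum_le_card_nsmul univ (fun j => B' j ω) 1 fun j _ => hB1 j ω
  have hSdiv (ω) : S ω / ∑ j, B' j ω = ∑ i, Y i * (B' i ω / ∑ j, B' j ω) := by
    simp only [S, sum_div, mul_div_assoc]
  have hSDint : Integrable (fun ω => S ω / ∑ j, B' j ω) P := by
    simp only [hSdiv]
    exact integrable_finsetSum _ fun i _ => (hDint i).const_mul _
  have h₁ : ∑ i, Y i * ∫ ω, (B' i ω / ∑ j, B' j ω) ∂P = ∫ ω, S ω / ∑ j, B' j ω ∂P := by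
    simp only [hSdiv]
    rw [integral_finsetSum _ fun i _ => (hDint i).const_mul _]
    simp only [integral_const_mul]
  have h₂ : ∑ i, Y i * (∫ ω, B' i ω ∂P) / M = ∫ ω, S ω / M ∂P := by
    rw [integral_div, integral_finsetSum _ fun i _ => (hBint i).const_mul _]
    simp only [integral_const_mul, sum_div]
  set G : Set Ω := {ω | A ≤ ∑ i, B' i ω ∧ ∑ i, B' i ω ≤ B}
  have hGm : MeasurableSet G :=
    (measurableSet_le measurable_const hNm).inter (measurableSet_le hNm measurable_const)
  have hGc : P.real Gᶜ ≤ ε := by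
    have h : 1 - ε ≤ P.real G := (ENNReal.ofReal_le_iff_le_toReal (measure_ne_top P G)).1 hP
    rw [probReal_compl_eq_one_sub hGm]
    linarith
  have hpt (ω) : |S ω / ∑ j, B' j ω - S ω / M| ≤
      (B - A) / A * (S ω / M) + Gᶜ.indicator (fun _ => n * K) ω := by
    by_cases hω : ω ∈ G
    · rw [Set.indicator_of_notMem (by simpa using hω), add_zero]
      exact abs_div_sub_div_le_of_mem_Icc hA0 (hS0 ω) hω.1 hω.2 hEN₁ hEN₂
    · rw [Set.indicator_of_mem (by simpa using hω)]
      have hrel : 0 ≤ (B - A) / A * (S ω / M) :=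
        mul_nonneg (div_nonneg (by linarith) hA0.le) (div_nonneg (hS0 ω) (by linarith))
      have hSK : S ω / ∑ j, B' j ω ≤ n * K :=
        (div_le_of_le_mul₀ (hN0 ω) hK0 (hSN ω)).trans (le_mul_of_one_le_left hK0 hn')
      have hSM : S ω / M ≤ n * K := by
        refine (div_le_self (hS0 ω) hM1).trans ((hSN ω).trans ?_)
        rw [mul_comm]
        exact mul_le_mul_of_nonneg_right (hNn ω) hK0
      exact (abs_sub_le_of_nonneg_of_le (div_nonneg (hS0 ω) (hN0 ω)) hSK
        (div_nonneg (hS0 ω) (by linarith)) hSM).trans (le_add_of_nonneg_left hrel)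
  have hMint : Integrable (fun ω => S ω / M) P := hSint.div_const M
  have hIint : Integrable (Gᶜ.indicator fun _ => n * K) P :=
    (integrable_const _).indicator hGm.compl
  rw [h₁, h₂, ← integral_sub hSDint hMint]
  calc |∫ ω, (S ω / ∑ j, B' j ω - S ω / M) ∂P|
      ≤ ∫ ω, |S ω / ∑ j, B' j ω - S ω / M| ∂P := abs_integral_le_integral_abs
    _ ≤ ∫ ω, ((B - A) / A * (S ω / M) + Gᶜ.indicator (fun _ => n * K) ω) ∂P :=
        integral_mono (hSDint.sub hMint).abs ((hMint.const_mul _).add hIint) hpt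
    _ = (B - A) / A * ∫ ω, S ω / M ∂P + P.real Gᶜ * (n * K) := by
        rw [integral_add (hMint.const_mul _) hIint, integral_const_mul,
          integral_indicator_const _ hGm.compl, smul_eq_mul]
    _ ≤ (B - A) / A * ∫ ω, S ω / M ∂P + ε * (n * K) := by gcongr
    _ = (B - A) / A * ∫ ω, S ω / M ∂P + n * ε * K := by ring
end

section
/- Let d ≥ 1 and k ≥ 0 be integers. For every x ∈ [0,1]^d, 2^{−(k+d)} ≤ ∫_{[0,1]^d} K_k^{uf}(0, |z−x|) dz ≤ 2^{d−k}. -/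
open MeasureTheory Finset

/-- `φ_k(y) = 1 - y ∑_{j<k} (-ln y)^j / j!` for `y ∈ (0,1]`, and `φ_k(0) = 1`. -/
noncomputable def phiUF (k : ℕ) (y : ℝ) : ℝ :=
  if y = 0 then 1
  else 1 - y * ∑ j ∈ Finset.range k, (-Real.log y) ^ j / (Nat.factorial j)

/-- The uniform connection function `K_k^uf(0, x)` on `[0,1]^d`. -/
noncomputable def Kuf (d k : ℕ) (x : Fin d → ℝ) : ℝ :=
  ∑ p ∈ Finset.univ.filter (fun p : Fin d → Fin (k + 1) => ∑ j, (p j : ℕ) = k),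
    ((Nat.factorial k : ℝ) / ∏ j, (Nat.factorial (p j : ℕ) : ℝ)) * (1 / d) ^ k *
      ∏ m, phiUF (p m : ℕ) (x m)

lemma phiUF_zero_left (y : ℝ) : phiUF 0 y = 1 := by
  simp [phiUF]

lemma phiUF_zero_right (k : ℕ) : phiUF k 0 = 1 := by
  simp [phiUF]

lemma phiUF_succ (k : ℕ) {y : ℝ} (hy : y ≠ 0) :
    phiUF (k + 1) y = phiUF k y - y * ((-Real.log y) ^ k / k.factorial) := by
  simp only [phiUF, if_neg hy, Finset.sum_range_succ]
  ring

lemma phiUF_succ_one (k : ℕ) : phiUF (k + 1) 1 = 0 := by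
  simp [phiUF, Finset.sum_range_succ']

lemma measurable_phiUF (k : ℕ) : Measurable (phiUF k) := by
  unfold phiUF
  refine Measurable.ite (measurableSet_singleton (0 : ℝ)) measurable_const ?_
  fun_prop

lemma hasDerivAt_phiUF_succ (k : ℕ) {y : ℝ} (hy : 0 < y) :
    HasDerivAt (phiUF (k + 1)) (-((-Real.log y) ^ k / k.factorial)) y := by
  have key (k : ℕ) : phiUF (k + 1) =ᶠ[nhds y]
      fun z => phiUF k z - z * ((-Real.log z) ^ k / k.factorial) := by
    filter_upwards [isOpen_ne.mem_nhds hy.ne'] with z hz using phiUF_succ k hz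
  induction k with
  | zero =>
    refine HasDerivAt.congr_of_eventuallyEq ?_ (key 0)
    simpa [phiUF_zero_left] using (hasDerivAt_id y).const_sub 1
  | succ k ih =>
    refine HasDerivAt.congr_of_eventuallyEq ?_ (key (k + 1))
    have h := ih.sub ((hasDerivAt_id y).mul
      ((((Real.hasDerivAt_log hy.ne').neg).pow (k + 1)).div_const ((k + 1).factorial : ℝ)))
    convert! h using 1
    simp only [id, Nat.factorial_succ, Nat.cast_mul, Nat.cast_add, Nat.cast_one, Pi.neg_apply,
      Pi.pow_apply, Nat.add_sub_cancel]
    have h1 : (k.factorial : ℝ) ≠ 0 := by positivity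
    have h2 : (k : ℝ) + 1 ≠ 0 := by positivity
    field_simp
    ring

lemma phiUF_le_one (k : ℕ) {y : ℝ} (hy : y ∈ Set.Icc (0 : ℝ) 1) : phiUF k y ≤ 1 := by
  unfold phiUF
  split_ifs
  · exact le_rfl
  · have hlog : 0 ≤ -Real.log y := neg_nonneg.2 (Real.log_nonpos hy.1 hy.2)
    have := mul_nonneg hy.1 (Finset.sum_nonneg fun j (_ : j ∈ Finset.range k) =>
      div_nonneg (pow_nonneg hlog j) (Nat.cast_nonneg j.factorial))
    linarith

lemma antitoneOn_phiUF (k : ℕ) : AntitoneOn (phiUF k) (Set.Icc 0 1) := by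
  cases k with
  | zero => intro a _ b _ _; simp [phiUF_zero_left]
  | succ k =>
    have h : AntitoneOn (phiUF (k + 1)) (Set.Ioc 0 1) := by
      refine antitoneOn_of_deriv_nonpos (convex_Ioc 0 1)
        (fun y hy => (hasDerivAt_phiUF_succ k hy.1).continuousAt.continuousWithinAt)
        (fun y hy => ?_) (fun y hy => ?_) <;> rw [interior_Ioc] at hy
      · exact (hasDerivAt_phiUF_succ k hy.1).differentiableAt.differentiableWithinAt
      · rw [(hasDerivAt_phiUF_succ k hy.1).deriv]
        have hlog : 0 ≤ -Real.log y := neg_nonneg.2 (Real.log_nonpos hy.1.le hy.2.le)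
        exact neg_nonpos.2 (by positivity)
    intro a ha b hb hab
    rcases ha.1.eq_or_lt with rfl | ha0
    · rw [phiUF_zero_right]
      exact phiUF_le_one _ hb
    · exact h ⟨ha0, ha.2⟩ ⟨ha0.trans_le hab, hb.2⟩ hab

lemma phiUF_nonneg (k : ℕ) {y : ℝ} (hy : y ∈ Set.Icc (0 : ℝ) 1) : 0 ≤ phiUF k y := by
  refine le_trans ?_ (antitoneOn_phiUF k hy (Set.right_mem_Icc.2 zero_le_one) hy.2)
  cases k with
  | zero => simp [phiUF_zero_left]
  | succ k => rw [phiUF_succ_one]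

lemma intervalIntegrable_phiUF (k : ℕ) {a b : ℝ} (ha : a ∈ Set.Icc (0 : ℝ) 1)
    (hb : b ∈ Set.Icc (0 : ℝ) 1) : IntervalIntegrable (phiUF k) volume a b :=
  ((antitoneOn_phiUF k).mono
    (Set.OrdConnected.uIcc_subset Set.ordConnected_Icc ha hb)).intervalIntegrable

/-- `y φ_{k+1}(y)` has derivative `2 φ_{k+1}(y) - φ_k(y)` and vanishes at both end points. -/
lemma two_mul_integral_phiUF_succ (k : ℕ) :
    2 * ∫ y in (0 : ℝ)..1, phiUF (k + 1) y = ∫ y in (0 : ℝ)..1, phiUF k y := by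
  have h0 : (0 : ℝ) ∈ Set.Icc (0 : ℝ) 1 := by simp
  have h1 : (1 : ℝ) ∈ Set.Icc (0 : ℝ) 1 := by simp
  have i1 := (intervalIntegrable_phiUF (k + 1) h0 h1).const_mul 2
  have i0 := intervalIntegrable_phiUF k h0 h1
  have hcont : ContinuousOn (fun y => y * phiUF (k + 1) y) (Set.Icc 0 1) := by
    intro y hy
    rcases hy.1.eq_or_lt with rfl | hy0
    · unfold ContinuousWithinAt
      simp only [zero_mul]
      refine squeeze_zero' (g := fun y => y) ?_ ?_
        (tendsto_nhdsWithin_of_tendsto_nhds Filter.tendsto_id)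
      · filter_upwards [self_mem_nhdsWithin] with y hy using
          mul_nonneg hy.1 (phiUF_nonneg _ hy)
      · filter_upwards [self_mem_nhdsWithin] with y hy using
          mul_le_of_le_one_right hy.1 (phiUF_le_one _ hy)
    · exact (continuousAt_id.mul (hasDerivAt_phiUF_succ k hy0).continuousAt).continuousWithinAt
  have key := intervalIntegral.integral_eq_sub_of_hasDerivAt_of_le zero_le_one hcont
    (f' := fun y => 2 * phiUF (k + 1) y - phiUF k y) (fun y hy => by
      have h := (hasDerivAt_id y).mul (hasDerivAt_phiUF_succ k hy.1)
      convert! h using 1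
      simp only [id, phiUF_succ k hy.1.ne']
      ring) (i1.sub i0)
  rw [intervalIntegral.integral_sub i1 i0, intervalIntegral.integral_const_mul,
    phiUF_succ_one] at key
  linarith

lemma integral_phiUF (k : ℕ) : ∫ y in (0 : ℝ)..1, phiUF k y = (1 / 2) ^ k := by
  induction k with
  | zero => simp [phiUF_zero_left]
  | succ k ih =>
    have := two_mul_integral_phiUF_succ k
    rw [pow_succ]
    linarith

lemma abs_sub_mem_Icc {x z : ℝ} (hx : x ∈ Set.Icc (0 : ℝ) 1) (hz : z ∈ Set.Icc (0 : ℝ) 1) :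
    |z - x| ∈ Set.Icc (0 : ℝ) 1 :=
  ⟨abs_nonneg _, abs_le.2 ⟨by linarith [hx.2, hz.1], by linarith [hx.1, hz.2]⟩⟩

lemma integrableOn_phiUF_abs_sub (k : ℕ) {x : ℝ} (hx : x ∈ Set.Icc (0 : ℝ) 1) :
    IntegrableOn (fun z => phiUF k |z - x|) (Set.Icc 0 1) := by
  refine Measure.integrableOn_of_bounded (M := 1) (by simp)
    ((measurable_phiUF k).comp (by fun_prop)).aestronglyMeasurable ?_
  filter_upwards [ae_restrict_mem measurableSet_Icc] with z hz
  have h := abs_sub_mem_Icc hx hz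
  rw [Real.norm_of_nonneg (phiUF_nonneg k h)]
  exact phiUF_le_one k h

lemma setIntegral_phiUF_abs_sub (k : ℕ) {x : ℝ} (hx : x ∈ Set.Icc (0 : ℝ) 1) :
    ∫ z in Set.Icc (0 : ℝ) 1, phiUF k |z - x| =
      (∫ y in (0 : ℝ)..x, phiUF k y) + ∫ y in (0 : ℝ)..(1 - x), phiUF k y := by
  have hint := integrableOn_phiUF_abs_sub k hx
  have h (a b : ℝ) (hab : a ≤ b) (ha : 0 ≤ a) (hb : b ≤ 1) :
      IntervalIntegrable (fun z => phiUF k |z - x|) volume a b :=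
    (intervalIntegrable_iff_integrableOn_Icc_of_le hab).2
      (hint.mono_set (Set.Icc_subset_Icc ha hb))
  rw [integral_Icc_eq_integral_Ioc, ← intervalIntegral.integral_of_le zero_le_one,
    ← intervalIntegral.integral_add_adjacent_intervals (h 0 x hx.1 le_rfl hx.2)
      (h x 1 hx.2 hx.1 le_rfl)]
  congr 1
  · have := intervalIntegral.integral_comp_sub_left (a := 0) (b := x) (phiUF k) x
    rw [sub_self, sub_zero] at this
    rw [← this]
    refine intervalIntegral.integral_congr fun z hz => ?_
    rw [Set.uIcc_of_le hx.1] at hz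
    simp only [abs_sub_comm z x, abs_of_nonneg (sub_nonneg.2 hz.2)]
  · have := intervalIntegral.integral_comp_sub_right (a := x) (b := 1) (phiUF k) x
    rw [sub_self] at this
    rw [← this]
    refine intervalIntegral.integral_congr fun z hz => ?_
    rw [Set.uIcc_of_le hx.2] at hz
    simp only [abs_of_nonneg (sub_nonneg.2 hz.1)]

lemma integral_phiUF_le (k : ℕ) {a : ℝ} (ha : a ∈ Set.Icc (0 : ℝ) 1) :
    ∫ y in (0 : ℝ)..a, phiUF k y ≤ (1 / 2) ^ k := by
  have h1 : (1 : ℝ) ∈ Set.Icc (0 : ℝ) 1 := by simp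
  rw [← integral_phiUF, ← intervalIntegral.integral_add_adjacent_intervals
    (intervalIntegrable_phiUF k (by simp) ha) (intervalIntegrable_phiUF k ha h1)]
  refine le_add_of_nonneg_right (intervalIntegral.integral_nonneg ha.2 fun y hy => ?_)
  exact phiUF_nonneg k ⟨ha.1.trans hy.1, hy.2⟩

lemma le_integral_phiUF_add (k : ℕ) {x : ℝ} (hx : x ∈ Set.Icc (0 : ℝ) 1) :
    (1 / 2) ^ k ≤ (∫ y in (0 : ℝ)..x, phiUF k y) + ∫ y in (0 : ℝ)..(1 - x), phiUF k y := by
  have h0 : (0 : ℝ) ∈ Set.Icc (0 : ℝ) 1 := by simp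
  have h1 : (1 : ℝ) ∈ Set.Icc (0 : ℝ) 1 := by simp
  have hx' : 1 - x ∈ Set.Icc (0 : ℝ) 1 := ⟨by linarith [hx.2], by linarith [hx.1]⟩
  rw [← integral_phiUF, ← intervalIntegral.integral_add_adjacent_intervals
    (intervalIntegrable_phiUF k h0 hx) (intervalIntegrable_phiUF k hx h1)]
  gcongr
  have hshift := intervalIntegral.integral_comp_add_right (a := 0) (b := 1 - x) (phiUF k) x
  rw [zero_add, sub_add_cancel] at hshift
  rw [← hshift]
  have hanti : AntitoneOn (fun y => phiUF k (y + x)) (Set.uIcc 0 (1 - x)) := by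
    rw [Set.uIcc_of_le hx'.1]
    intro a ha b hb hab
    exact antitoneOn_phiUF k ⟨by linarith [ha.1, hx.1], by linarith [ha.2]⟩
      ⟨by linarith [hb.1, hx.1], by linarith [hb.2]⟩ (by linarith)
  refine intervalIntegral.integral_mono_on hx'.1 hanti.intervalIntegrable
    (intervalIntegrable_phiUF k h0 hx') fun y hy => ?_
  exact antitoneOn_phiUF k ⟨hy.1, hy.2.trans hx'.2⟩
    ⟨by linarith [hy.1, hx.1], by linarith [hy.2]⟩ (by linarith [hx.1])

lemma setIntegral_phiUF_abs_sub_mem (k : ℕ) {x : ℝ} (hx : x ∈ Set.Icc (0 : ℝ) 1) :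
    ∫ z in Set.Icc (0 : ℝ) 1, phiUF k |z - x| ∈ Set.Icc ((1 / 2 : ℝ) ^ k) (2 * (1 / 2) ^ k) := by
  rw [setIntegral_phiUF_abs_sub k hx]
  refine ⟨le_integral_phiUF_add k hx, ?_⟩
  linarith [integral_phiUF_le k hx,
    integral_phiUF_le k (a := 1 - x) ⟨by linarith [hx.2], by linarith [hx.1]⟩]

lemma volume_restrict_Icc_pi (d : ℕ) :
    (volume : Measure (Fin d → ℝ)).restrict (Set.Icc 0 1) =
      Measure.pi fun _ => (volume : Measure ℝ).restrict (Set.Icc 0 1) := by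
  rw [← Measure.restrict_pi_pi, ← volume_pi, Set.pi_univ_Icc]
  rfl

/-- The multinomial theorem at `(1, …, 1)`, with bounded exponents as index set. -/
lemma sum_factorial_div_prod_factorial (d k : ℕ) :
    ∑ p ∈ Finset.univ.filter (fun p : Fin d → Fin (k + 1) => ∑ j, (p j : ℕ) = k),
      ((Nat.factorial k : ℝ) / ∏ j, (Nat.factorial (p j : ℕ) : ℝ)) = (d : ℝ) ^ k := by
  have h := Finset.sum_pow_eq_sum_piAntidiag (Finset.univ : Finset (Fin d)) (fun _ => (1 : ℝ)) k
  simp only [Finset.sum_const, Finset.card_univ, Fintype.card_fin, nsmul_eq_mul, mul_one, one_pow,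
    Finset.prod_const_one] at h
  rw [h]
  refine Finset.sum_bij (fun p _ j => (p j : ℕ)) (fun p hp => ?_) (fun p _ q _ hpq => ?_)
    (fun f hf => ?_) (fun p hp => ?_)
  · simpa using hp
  · funext j
    exact Fin.ext (congrFun hpq j)
  · have hf' : ∑ j, f j = k := (Finset.mem_piAntidiag.1 hf).1
    refine ⟨fun j => ⟨f j, Nat.lt_succ_of_le ?_⟩, by simpa using hf', rfl⟩
    rw [← hf']
    exact Finset.single_le_sum (fun _ _ => Nat.zero_le _) (Finset.mem_univ j)
  · have hp' : ∑ j, (p j : ℕ) = k := (Finset.mem_filter.1 hp).2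
    have hs := Nat.multinomial_spec Finset.univ (fun j => (p j : ℕ))
    rw [hp'] at hs
    rw [← hs]
    push_cast
    rw [mul_div_cancel_left₀]
    positivity

lemma integral_Kuf_abs_sub (d k : ℕ) {x : Fin d → ℝ} (hx : ∀ j, x j ∈ Set.Icc (0 : ℝ) 1) :
    ∫ z in Set.Icc (0 : Fin d → ℝ) 1, Kuf d k (fun j => |z j - x j|) =
      ∑ p ∈ Finset.univ.filter (fun p : Fin d → Fin (k + 1) => ∑ j, (p j : ℕ) = k),
        ((Nat.factorial k : ℝ) / ∏ j, (Nat.factorial (p j : ℕ) : ℝ)) * (1 / d) ^ k *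
          ∏ m, ∫ z in Set.Icc (0 : ℝ) 1, phiUF (p m : ℕ) |z - x m| := by
  unfold Kuf
  rw [volume_restrict_Icc_pi, integral_finsetSum]
  · refine Finset.sum_congr rfl fun p _ => ?_
    rw [integral_const_mul]
    congr 1
    exact integral_fintype_prod_eq_prod (f := fun m z => phiUF (p m : ℕ) |z - x m|)
  · intro p _
    exact (Integrable.fintype_prod (f := fun m z => phiUF (p m : ℕ) |z - x m|)
      fun m => integrableOn_phiUF_abs_sub _ (hx m)).const_mul _

/-- Bounds on the integral of the translation-invariant uniform connection function:
`2^{-(k+d)} ≤ ∫_{[0,1]^d} K_k^uf(0, |z - x|) dz ≤ 2^{d-k}`. -/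
theorem integral_Kuf_bounds (d k : ℕ) (hd : 1 ≤ d)
    (x : Fin d → ℝ) (hx : ∀ j, x j ∈ Set.Icc (0 : ℝ) 1) :
    (2 : ℝ) ^ (-((k : ℤ) + d)) ≤
        (∫ z in Set.Icc (0 : Fin d → ℝ) 1, Kuf d k (fun j => |z j - x j|)) ∧
      (∫ z in Set.Icc (0 : Fin d → ℝ) 1, Kuf d k (fun j => |z j - x j|))
        ≤ (2 : ℝ) ^ ((d : ℤ) - k) := by
  have hd0 : (d : ℝ) ≠ 0 := by positivity
  have hsum (c : ℝ) :
      ∑ p ∈ Finset.univ.filter (fun p : Fin d → Fin (k + 1) => ∑ j, (p j : ℕ) = k),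
        ((Nat.factorial k : ℝ) / ∏ j, (Nat.factorial (p j : ℕ) : ℝ)) * (1 / d) ^ k * c = c := by
    rw [← Finset.sum_mul, ← Finset.sum_mul, sum_factorial_div_prod_factorial, ← mul_pow,
      mul_one_div_cancel hd0, one_pow, one_mul]
  rw [integral_Kuf_abs_sub d k hx]
  constructor
  · calc (2 : ℝ) ^ (-((k : ℤ) + d)) ≤ (1 / 2) ^ k := by
          rw [one_div, inv_pow, ← zpow_natCast, ← zpow_neg]
          exact zpow_le_zpow_right₀ one_le_two (by omega)
      _ ≤ _ := by
          rw [← hsum ((1 / 2) ^ k)]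
          refine Finset.sum_le_sum fun p hp => mul_le_mul_of_nonneg_left ?_ (by positivity)
          have hprod : (1 / 2 : ℝ) ^ k = ∏ m, (1 / 2 : ℝ) ^ (p m : ℕ) := by
            rw [Finset.prod_pow_eq_pow_sum, (Finset.mem_filter.1 hp).2]
          rw [hprod]
          exact Finset.prod_le_prod (fun _ _ => by positivity)
            fun m _ => (setIntegral_phiUF_abs_sub_mem _ (hx m)).1
  · have hpow : (2 : ℝ) ^ ((d : ℤ) - k) = 2 ^ d * (1 / 2) ^ k := by
      rw [zpow_sub₀ two_ne_zero, zpow_natCast, zpow_natCast, one_div, inv_pow, div_eq_mul_inv]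
    rw [hpow, ← hsum (2 ^ d * (1 / 2) ^ k)]
    refine Finset.sum_le_sum fun p hp => mul_le_mul_of_nonneg_left ?_ (by positivity)
    have hprod : (2 : ℝ) ^ d * (1 / 2) ^ k = ∏ m, 2 * (1 / 2 : ℝ) ^ (p m : ℕ) := by
      rw [Finset.prod_mul_distrib, Finset.prod_pow_eq_pow_sum, (Finset.mem_filter.1 hp).2]
      simp
    rw [hprod]
    exact Finset.prod_le_prod
      (fun m _ => le_trans (by positivity) (setIntegral_phiUF_abs_sub_mem _ (hx m)).1)
      fun m _ => (setIntegral_phiUF_abs_sub_mem _ (hx m)).2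
end

section
/- Let d ≥ 1 and k ≥ 0 be integers, let L > 0, and let f : [0,1]^d → ℝ be L-Lipschitz. Then for every x ∈ (0,1]^d, |(∫_{[0,1]^d} K_k^{cc}(x,z) f(z) dz) / (∫_{[0,1]^d} K_k^{cc}(x,z) dz) − f(x)| ≤ L·d·(1 − 1/(2d))^k. -/
open MeasureTheory Finset

/-- The centred connection function `K_k^cc` on `[0,1]^d × [0,1]^d`. -/
noncomputable def Kcc (d k : ℕ) (x z : Fin d → ℝ) : ℝ :=
  ∑ p ∈ Finset.univ.filter (fun p : Fin d → Fin (k + 1) => ∑ j, (p j : ℕ) = k),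
    ((Nat.factorial k : ℝ) / ∏ j, (Nat.factorial (p j : ℕ) : ℝ)) * (1 / d) ^ k *
      ∏ j, (if ⌈(2 : ℝ) ^ (p j : ℕ) * x j⌉ = ⌈(2 : ℝ) ^ (p j : ℕ) * z j⌉ then (1 : ℝ) else 0)

/-- The dyadic cell of side lengths `2 ^ (-p j)` containing `x`. -/
def dyadicCell {d : ℕ} (p : Fin d → ℕ) (x : Fin d → ℝ) : Set (Fin d → ℝ) :=
  Set.univ.pi fun j =>
    Set.Ioc ((⌈(2 : ℝ) ^ p j * x j⌉ - 1 : ℝ) / 2 ^ p j) (⌈(2 : ℝ) ^ p j * x j⌉ / 2 ^ p j)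

lemma mem_dyadicCell {d : ℕ} {p : Fin d → ℕ} {x z : Fin d → ℝ} :
    z ∈ dyadicCell p x ↔ ∀ j, ⌈(2 : ℝ) ^ p j * x j⌉ = ⌈(2 : ℝ) ^ p j * z j⌉ := by
  simp only [dyadicCell, Set.mem_univ_pi, Set.mem_Ioc]
  refine forall_congr' fun j => ?_
  have h2 : (0 : ℝ) < 2 ^ p j := by positivity
  rw [eq_comm, Int.ceil_eq_iff, div_lt_iff₀ h2, le_div_iff₀ h2, mul_comm (z j)]

lemma measurableSet_dyadicCell {d : ℕ} (p : Fin d → ℕ) (x : Fin d → ℝ) :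
    MeasurableSet (dyadicCell p x) :=
  MeasurableSet.univ_pi fun _ => measurableSet_Ioc

lemma volume_real_dyadicCell {d : ℕ} (p : Fin d → ℕ) (x : Fin d → ℝ) :
    volume.real (dyadicCell p x) = (1 / 2) ^ ∑ j, p j := by
  rw [dyadicCell, measureReal_def, Real.volume_pi_Ioc, ENNReal.toReal_prod,
    ← Finset.prod_pow_eq_pow_sum]
  refine Finset.prod_congr rfl fun j _ => ?_
  rw [← sub_div, sub_sub_cancel, ENNReal.toReal_ofReal (by positivity), div_pow, one_pow]

lemma dyadicCell_subset_Icc {d : ℕ} (p : Fin d → ℕ) {x : Fin d → ℝ}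
    (hx : ∀ j, x j ∈ Set.Ioc (0 : ℝ) 1) : dyadicCell p x ⊆ Set.Icc 0 1 := by
  intro z hz
  simp only [dyadicCell, Set.mem_univ_pi, Set.mem_Ioc] at hz
  have key : ∀ j, 0 ≤ z j ∧ z j ≤ 1 := by
    intro j
    have h2 : (0 : ℝ) < 2 ^ p j := by positivity
    have hpos : (1 : ℤ) ≤ ⌈(2 : ℝ) ^ p j * x j⌉ :=
      Int.ceil_pos.2 (mul_pos h2 (hx j).1)
    have hle : ⌈(2 : ℝ) ^ p j * x j⌉ ≤ (2 : ℤ) ^ p j := by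
      refine Int.ceil_le.2 ?_
      push_cast
      exact mul_le_of_le_one_right h2.le (hx j).2
    have hpos' : (1 : ℝ) ≤ ⌈(2 : ℝ) ^ p j * x j⌉ := by exact_mod_cast hpos
    have hle' : (⌈(2 : ℝ) ^ p j * x j⌉ : ℝ) ≤ 2 ^ p j := by exact_mod_cast hle
    exact ⟨(div_nonneg (sub_nonneg.2 hpos') h2.le).trans (hz j).1.le,
      (hz j).2.trans ((div_le_one h2).2 hle')⟩
  exact ⟨fun j => (key j).1, fun j => (key j).2⟩

lemma abs_sub_le_of_mem_dyadicCell {d : ℕ} {p : Fin d → ℕ} {x z : Fin d → ℝ}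
    (hz : z ∈ dyadicCell p x) (j : Fin d) : |z j - x j| ≤ (1 / 2) ^ p j := by
  have hx : x ∈ dyadicCell p x := mem_dyadicCell.2 fun _ => rfl
  simp only [dyadicCell, Set.mem_univ_pi, Set.mem_Ioc, sub_div] at hx hz
  rw [one_div_pow, abs_le]
  constructor <;> linarith [(hx j).1, (hx j).2, (hz j).1, (hz j).2]

/-- The index set of the sum defining `Kcc`. -/
abbrev splitCounts (d k : ℕ) : Finset (Fin d → Fin (k + 1)) :=
  Finset.univ.filter fun p => ∑ j, (p j : ℕ) = k

/-- The weight of a tuple of split counts in `Kcc`. -/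
noncomputable abbrev splitWeight {d k : ℕ} (p : Fin d → Fin (k + 1)) : ℝ :=
  ((Nat.factorial k : ℝ) / ∏ j, (Nat.factorial (p j : ℕ) : ℝ)) * (1 / d) ^ k

lemma Kcc_eq_sum_indicator (d k : ℕ) (x z : Fin d → ℝ) :
    Kcc d k x z = ∑ p ∈ splitCounts d k,
      splitWeight p * (dyadicCell (fun j => (p j : ℕ)) x).indicator 1 z := by
  refine Finset.sum_congr rfl fun p _ => ?_
  congr 1
  rw [Finset.prod_ite_zero]
  by_cases hz : z ∈ dyadicCell (fun j => (p j : ℕ)) x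
  · simpa [hz] using mem_dyadicCell.1 hz
  · simpa [hz] using mt mem_dyadicCell.2 hz

lemma setIntegral_Kcc_mul {d k : ℕ} {x : Fin d → ℝ} (hx : ∀ j, x j ∈ Set.Ioc (0 : ℝ) 1)
    {g : (Fin d → ℝ) → ℝ} (hg : IntegrableOn g (Set.Icc 0 1)) :
    ∫ z in Set.Icc (0 : Fin d → ℝ) 1, Kcc d k x z * g z =
      ∑ p ∈ splitCounts d k,
        splitWeight p * ∫ z in dyadicCell (fun j => (p j : ℕ)) x, g z := by
  have hK : ∀ z, Kcc d k x z * g z = ∑ p ∈ splitCounts d k,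
      splitWeight p * (dyadicCell (fun j => (p j : ℕ)) x).indicator g z := by
    intro z
    rw [Kcc_eq_sum_indicator, Finset.sum_mul]
    refine Finset.sum_congr rfl fun p _ => ?_
    by_cases hz : z ∈ dyadicCell (fun j => (p j : ℕ)) x <;> simp [hz]
  simp_rw [hK]
  rw [integral_finsetSum _ fun p _ =>
    (hg.indicator (measurableSet_dyadicCell _ x)).const_mul _]
  refine Finset.sum_congr rfl fun p _ => ?_
  rw [integral_const_mul, setIntegral_indicator (measurableSet_dyadicCell _ x),
    Set.inter_eq_right.2 (dyadicCell_subset_Icc _ hx)]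

/-- The multinomial theorem, indexed by the split counts. -/
lemma sum_splitWeight_mul_prod_pow (d k : ℕ) (a : Fin d → ℝ) :
    ∑ p ∈ splitCounts d k, splitWeight p * ∏ j, a j ^ (p j : ℕ) = ((∑ j, a j) / d) ^ k := by
  rw [div_pow, Finset.sum_pow_eq_sum_piAntidiag, div_eq_mul_one_div, ← one_div_pow, Finset.sum_mul]
  refine Finset.sum_bij' (fun p _ j => (p j : ℕ)) (fun q hq j => ⟨q j, ?_⟩) ?_ ?_ ?_ ?_ ?_
  · have := (Finset.mem_piAntidiag.1 hq).1
    exact Nat.lt_succ_of_le (this ▸ Finset.single_le_sum (fun _ _ => Nat.zero_le _) (mem_univ j))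
  · intro p hp
    simpa [Finset.mem_piAntidiag] using hp
  · intro q hq
    simpa [Finset.mem_piAntidiag] using hq
  · intro p _
    rfl
  · intro q _
    rfl
  · intro p hp
    have hp' : ∑ j, (p j : ℕ) = k := (Finset.mem_filter.1 hp).2
    have hdvd := Nat.prod_factorial_dvd_factorial_sum univ fun j => (p j : ℕ)
    rw [hp'] at hdvd
    rw [Nat.multinomial, hp', Nat.cast_div hdvd (by positivity)]
    push_cast
    ring

lemma sum_splitWeight {d : ℕ} (hd : 1 ≤ d) (k : ℕ) :
    ∑ p ∈ splitCounts d k, splitWeight p = 1 := by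
  have hd0 : (d : ℝ) ≠ 0 := by positivity
  simpa [hd0] using sum_splitWeight_mul_prod_pow d k fun _ => 1

lemma sum_splitWeight_mul_half_pow {d : ℕ} (hd : 1 ≤ d) (k : ℕ) (i : Fin d) :
    ∑ p ∈ splitCounts d k, splitWeight p * (1 / 2) ^ (p i : ℕ) = (1 - 1 / (2 * d)) ^ k := by
  have hd0 : (d : ℝ) ≠ 0 := by positivity
  have h := sum_splitWeight_mul_prod_pow d k (Function.update 1 i (1 / 2))
  have hprod : ∀ p : Fin d → Fin (k + 1),
      ∏ j, (Function.update (1 : Fin d → ℝ) i (1 / 2)) j ^ (p j : ℕ) = (1 / 2) ^ (p i : ℕ) := by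
    intro p
    rw [Finset.prod_eq_single i (fun j _ hj => by simp [hj]) (by simp), Function.update_self]
  have hsum : ∑ j, (Function.update (1 : Fin d → ℝ) i (1 / 2)) j = d - 1 / 2 := by
    rw [Finset.sum_update_of_mem (mem_univ i), Finset.sum_eq_card_nsmul (b := 1) (by simp)]
    simp [Finset.card_sdiff, Nat.cast_sub hd]
    ring
  simp_rw [hprod, hsum] at h
  rw [h]
  congr 1
  field_simp

/-- Bias bound for the infinite centred KeRF: if `f` is `L`-Lipschitz on `[0,1]^d`, then
the normalized kernel average of `f` at `x` deviates from `f x` by at most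
`L d (1 - 1/(2d))^k`. -/
theorem centred_kerf_bias (d k : ℕ) (hd : 1 ≤ d) (L : ℝ) (hL : 0 < L)
    (f : (Fin d → ℝ) → ℝ)
    (hf : LipschitzOnWith (Real.toNNReal L) f (Set.Icc (0 : Fin d → ℝ) 1))
    (x : Fin d → ℝ) (hx : ∀ j, x j ∈ Set.Ioc (0 : ℝ) 1) :
    |(∫ z in Set.Icc (0 : Fin d → ℝ) 1, Kcc d k x z * f z) /
        (∫ z in Set.Icc (0 : Fin d → ℝ) 1, Kcc d k x z) - f x|
      ≤ L * d * (1 - 1 / (2 * d)) ^ k := by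
  set Q := Set.Icc (0 : Fin d → ℝ) 1
  have hxQ : x ∈ Q := ⟨fun j => (hx j).1.le, fun j => (hx j).2⟩
  have hfint : IntegrableOn f Q := hf.continuousOn.integrableOn_compact isCompact_Icc
  have hcint : ∀ c : ℝ, IntegrableOn (fun _ => c) Q := fun c =>
    continuousOn_const.integrableOn_compact isCompact_Icc
  have hvol : ∀ p ∈ splitCounts d k,
      volume.real (dyadicCell (fun j => (p j : ℕ)) x) = (1 / 2) ^ k := fun p hp => by
    rw [volume_real_dyadicCell, (Finset.mem_filter.1 hp).2]
  have hden : ∫ z in Q, Kcc d k x z = (1 / 2) ^ k := by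
    have h := setIntegral_Kcc_mul (k := k) hx (hcint 1)
    simp only [mul_one] at h
    rw [h]
    calc _ = ∑ p ∈ splitCounts d k, splitWeight p * (1 / 2 : ℝ) ^ k :=
          Finset.sum_congr rfl fun p hp => by
            rw [setIntegral_const, hvol p hp, smul_eq_mul, mul_one]
      _ = _ := by rw [← Finset.sum_mul, sum_splitWeight hd, one_mul]
  have hnum : (∫ z in Q, Kcc d k x z * f z) - f x * (1 / 2) ^ k =
      ∑ p ∈ splitCounts d k,
        splitWeight p * ∫ z in dyadicCell (fun j => (p j : ℕ)) x, (f z - f x) := by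
    have hconst : f x * (1 / 2) ^ k =
        ∑ p ∈ splitCounts d k, splitWeight p * (f x * (1 / 2) ^ k) := by
      rw [← Finset.sum_mul, sum_splitWeight hd, one_mul]
    rw [setIntegral_Kcc_mul hx hfint, hconst, ← Finset.sum_sub_distrib]
    refine Finset.sum_congr rfl fun p hp => ?_
    have hsub := dyadicCell_subset_Icc (fun j => (p j : ℕ)) hx
    rw [integral_sub (hfint.mono_set hsub) ((hcint _).mono_set hsub), setIntegral_const,
      hvol p hp, smul_eq_mul]
    ring
  have hbound : ∀ p ∈ splitCounts d k,
      |∫ z in dyadicCell (fun j => (p j : ℕ)) x, (f z - f x)| ≤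
        (L * ∑ j, (1 / 2) ^ (p j : ℕ)) * (1 / 2) ^ k := by
    intro p hp
    have hsub := dyadicCell_subset_Icc (fun j => (p j : ℕ)) hx
    rw [← hvol p hp, ← Real.norm_eq_abs]
    refine norm_setIntegral_le_of_norm_le_const
      ((measure_mono hsub).trans_lt isCompact_Icc.measure_lt_top) fun z hz => ?_
    have hlip := hf.dist_le_mul z (hsub hz) x hxQ
    rw [Real.coe_toNNReal L hL.le, Real.dist_eq] at hlip
    refine hlip.trans (mul_le_mul_of_nonneg_left ?_ hL.le)
    refine (dist_pi_le_iff (by positivity)).2 fun j => ?_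
    rw [Real.dist_eq]
    exact (abs_sub_le_of_mem_dyadicCell hz j).trans
      (Finset.single_le_sum (f := fun j => (1 / 2 : ℝ) ^ (p j : ℕ))
        (fun _ _ => by positivity) (mem_univ j))
  have hpos : (0 : ℝ) < (1 / 2) ^ k := by positivity
  rw [hden, div_sub' hpos.ne', abs_div, abs_of_pos hpos, div_le_iff₀ hpos, mul_comm _ (f x), hnum]
  calc _ ≤ ∑ p ∈ splitCounts d k,
        splitWeight p * ((L * ∑ j, (1 / 2) ^ (p j : ℕ)) * (1 / 2) ^ k) := by
        refine (Finset.abs_sum_le_sum_abs _ _).trans (Finset.sum_le_sum fun p hp => ?_)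
        have hw : 0 ≤ splitWeight p := by positivity
        rw [abs_mul, abs_of_nonneg hw]
        exact mul_le_mul_of_nonneg_left (hbound p hp) hw
    _ = L * (∑ j, ∑ p ∈ splitCounts d k, splitWeight p * (1 / 2) ^ (p j : ℕ)) * (1 / 2) ^ k := by
        rw [Finset.sum_comm, Finset.mul_sum, Finset.sum_mul]
        refine Finset.sum_congr rfl fun p _ => ?_
        rw [← Finset.mul_sum]
        ring
    _ = _ := by
        simp_rw [sum_splitWeight_mul_half_pow hd]
        simp [mul_assoc]
end
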